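/- Let 𝔼 = ⟨ℰ, B⟩ be an epistemic space and ∘ an extended credibility-limited revision operator for 𝔼, and for each Ψ ∈ ℰ define C_Ψ = {ω ∈ Ω : ⟦Ψ∘φ_ω⟧ = {ω}}. Then for every Ψ ∈ ℰ and every consistent formula α with ⟦α⟧ ∩ C_Ψ = ∅, it holds that ⟦Ψ∘α⟧ = ⟦Ψ⟧. -/

import Mathlib

namespace CLR

/-- Propositional formulas over a signature `V` (with falsum `⊥` and implication;
other connectives are defined). -/
inductive Form (V : Type) : Type
  | atom : V → Form V
  | fls  : Form V
  | imp  : Form V → Form V → Form V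

namespace Form

variable {V : Type}

/-- Negation `¬φ := φ → ⊥`. -/
def neg (φ : Form V) : Form V := Form.imp φ Form.fls

/-- Verum `⊤ := ¬⊥`. -/
def tru : Form V := neg (Form.fls : Form V)

/-- Disjunction `φ ∨ ψ := ¬φ → ψ`. -/
def or' (φ ψ : Form V) : Form V := Form.imp (neg φ) ψ

/-- Conjunction `φ ∧ ψ := ¬(¬φ ∨ ¬ψ)`. -/
def and' (φ ψ : Form V) : Form V := neg (or' (neg φ) (neg ψ))

/-- Evaluation of a formula in an interpretation `w : V → Bool`. -/
def eval (w : V → Bool) : Form V → Bool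
  | atom v => w v
  | fls => false
  | imp φ ψ => !(eval w φ) || eval w ψ

end Form

/-- Interpretations (possible worlds) over signature `V`. -/
abbrev World (V : Type) := V → Bool

/-- The set of models `⟦φ⟧` of a formula. -/
def mods {V : Type} (φ : Form V) : Set (World V) := {w | φ.eval w = true}

/-- The set of models `⟦X⟧` of a set of formulas. -/
def modsSet {V : Type} (X : Set (Form V)) : Set (World V) :=
  {w | ∀ φ ∈ X, φ.eval w = true}

/-- Deductive closure (via semantic entailment, which is adequate for
classical propositional logic). -/
def Cn {V : Type} (X : Set (Form V)) : Set (Form V) :=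
  {φ | ∀ w ∈ modsSet X, w ∈ mods φ}

/-- Expansion: `X + α` is the deductive closure of `X ∪ {α}`. -/
def plus {V : Type} (X : Set (Form V)) (α : Form V) : Set (Form V) :=
  Cn (X ∪ {α})

/-- A formula is consistent if it has a model. -/
def FormConsistent {V : Type} (φ : Form V) : Prop := (mods φ).Nonempty

/-- A set of formulas is consistent if it has a model. -/
def SetConsistent {V : Type} (X : Set (Form V)) : Prop := (modsSet X).Nonempty

/-- An epistemic space `𝔼 = ⟨ℰ, B⟩`: each epistemic state `Ψ : E` has a
deductively closed belief set `B Ψ`. -/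
structure EpistemicSpace (V E : Type) where
  B : E → Set (Form V)
  closed : ∀ Ψ, B Ψ = Cn (B Ψ)

variable {V E : Type}

/-- Models `⟦Ψ⟧` of the belief set of an epistemic state. -/
def modsOf (ES : EpistemicSpace V E) (Ψ : E) : Set (World V) := modsSet (ES.B Ψ)

/-- (R1) `α ∈ B(Ψ∘α)`. -/
def R1 (ES : EpistemicSpace V E) (circ : E → Form V → E) : Prop :=
  ∀ Ψ α, α ∈ ES.B (circ Ψ α)

/-- (R2) `B(Ψ∘α) = B(Ψ)+α` whenever `B(Ψ)+α` is consistent. -/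
def R2 (ES : EpistemicSpace V E) (circ : E → Form V → E) : Prop :=
  ∀ Ψ α, SetConsistent (plus (ES.B Ψ) α) → ES.B (circ Ψ α) = plus (ES.B Ψ) α

/-- (R3) if `α` is consistent then `B(Ψ∘α)` is consistent. -/
def R3 (ES : EpistemicSpace V E) (circ : E → Form V → E) : Prop :=
  ∀ Ψ α, FormConsistent α → SetConsistent (ES.B (circ Ψ α))

/-- (R4) if `α ≡ β` then `B(Ψ∘α) = B(Ψ∘β)`. -/
def R4 (ES : EpistemicSpace V E) (circ : E → Form V → E) : Prop :=
  ∀ Ψ α β, mods α = mods β → ES.B (circ Ψ α) = ES.B (circ Ψ β)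

/-- (R5) `B(Ψ∘(α∧β)) ⊆ B(Ψ∘α)+β`. -/
def R5 (ES : EpistemicSpace V E) (circ : E → Form V → E) : Prop :=
  ∀ Ψ α β, ES.B (circ Ψ (Form.and' α β)) ⊆ plus (ES.B (circ Ψ α)) β

/-- (R6) if `B(Ψ∘α)+β` is consistent then `B(Ψ∘α)+β ⊆ B(Ψ∘(α∧β))`. -/
def R6 (ES : EpistemicSpace V E) (circ : E → Form V → E) : Prop :=
  ∀ Ψ α β, SetConsistent (plus (ES.B (circ Ψ α)) β) →
    plus (ES.B (circ Ψ α)) β ⊆ ES.B (circ Ψ (Form.and' α β))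

/-- AGM revision operator: satisfies (R1)–(R6). -/
def AGMRev (ES : EpistemicSpace V E) (circ : E → Form V → E) : Prop :=
  R1 ES circ ∧ R2 ES circ ∧ R3 ES circ ∧ R4 ES circ ∧ R5 ES circ ∧ R6 ES circ

/-- (CL1) `α ∈ B(Ψ∘α)` or `B(Ψ∘α) = B(Ψ)`. -/
def CL1 (ES : EpistemicSpace V E) (circ : E → Form V → E) : Prop :=
  ∀ Ψ α, α ∈ ES.B (circ Ψ α) ∨ ES.B (circ Ψ α) = ES.B Ψ

/-- (CL2) `B(Ψ∘α) = B(Ψ)+α` whenever `B(Ψ)+α` is consistent. -/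
def CL2 (ES : EpistemicSpace V E) (circ : E → Form V → E) : Prop :=
  ∀ Ψ α, SetConsistent (plus (ES.B Ψ) α) → ES.B (circ Ψ α) = plus (ES.B Ψ) α

/-- (CL3) `B(Ψ∘α)` is consistent. -/
def CL3 (ES : EpistemicSpace V E) (circ : E → Form V → E) : Prop :=
  ∀ Ψ α, SetConsistent (ES.B (circ Ψ α))

/-- (CL4) if `α ≡ β` then `B(Ψ∘α) = B(Ψ∘β)`. -/
def CL4 (ES : EpistemicSpace V E) (circ : E → Form V → E) : Prop :=
  ∀ Ψ α β, mods α = mods β → ES.B (circ Ψ α) = ES.B (circ Ψ β)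

/-- (CL5) if `α ∈ B(Ψ∘α)` and `α ⊨ β` then `β ∈ B(Ψ∘β)`. -/
def CL5 (ES : EpistemicSpace V E) (circ : E → Form V → E) : Prop :=
  ∀ Ψ α β, α ∈ ES.B (circ Ψ α) → mods α ⊆ mods β → β ∈ ES.B (circ Ψ β)

/-- (CL6) `B(Ψ∘(α∨β))` equals `B(Ψ∘α)`, or `B(Ψ∘β)`, or `B(Ψ∘α) ∩ B(Ψ∘β)`. -/
def CL6 (ES : EpistemicSpace V E) (circ : E → Form V → E) : Prop :=
  ∀ Ψ α β,
    ES.B (circ Ψ (Form.or' α β)) = ES.B (circ Ψ α) ∨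
    ES.B (circ Ψ (Form.or' α β)) = ES.B (circ Ψ β) ∨
    ES.B (circ Ψ (Form.or' α β)) = ES.B (circ Ψ α) ∩ ES.B (circ Ψ β)

/-- Credibility-limited revision operator: satisfies (CL1)–(CL6). -/
def CLRev (ES : EpistemicSpace V E) (circ : E → Form V → E) : Prop :=
  CL1 ES circ ∧ CL2 ES circ ∧ CL3 ES circ ∧ CL4 ES circ ∧ CL5 ES circ ∧ CL6 ES circ

/-- (ECL1) = (CL1). -/
def ECL1 (ES : EpistemicSpace V E) (circ : E → Form V → E) : Prop :=
  ∀ Ψ α, α ∈ ES.B (circ Ψ α) ∨ ES.B (circ Ψ α) = ES.B Ψ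

/-- (ECL2) = (CL2). -/
def ECL2 (ES : EpistemicSpace V E) (circ : E → Form V → E) : Prop :=
  ∀ Ψ α, SetConsistent (plus (ES.B Ψ) α) → ES.B (circ Ψ α) = plus (ES.B Ψ) α

/-- (ECL3) if `B(Ψ∘α)` is inconsistent then `B(Ψ)` or `α` is inconsistent. -/
def ECL3 (ES : EpistemicSpace V E) (circ : E → Form V → E) : Prop :=
  ∀ Ψ α, ¬ SetConsistent (ES.B (circ Ψ α)) →
    ¬ SetConsistent (ES.B Ψ) ∨ ¬ FormConsistent α

/-- (ECL4) if `B(Ψ∘α)` is consistent and `α ⊨ β` then `B(Ψ∘β)` is consistent. -/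
def ECL4 (ES : EpistemicSpace V E) (circ : E → Form V → E) : Prop :=
  ∀ Ψ α β, SetConsistent (ES.B (circ Ψ α)) → mods α ⊆ mods β →
    SetConsistent (ES.B (circ Ψ β))

/-- (ECL5) = (CL4). -/
def ECL5 (ES : EpistemicSpace V E) (circ : E → Form V → E) : Prop :=
  ∀ Ψ α β, mods α = mods β → ES.B (circ Ψ α) = ES.B (circ Ψ β)

/-- (ECL6) = (CL5). -/
def ECL6 (ES : EpistemicSpace V E) (circ : E → Form V → E) : Prop :=
  ∀ Ψ α β, α ∈ ES.B (circ Ψ α) → mods α ⊆ mods β → β ∈ ES.B (circ Ψ β)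

/-- (ECL7) = (CL6). -/
def ECL7 (ES : EpistemicSpace V E) (circ : E → Form V → E) : Prop :=
  ∀ Ψ α β,
    ES.B (circ Ψ (Form.or' α β)) = ES.B (circ Ψ α) ∨
    ES.B (circ Ψ (Form.or' α β)) = ES.B (circ Ψ β) ∨
    ES.B (circ Ψ (Form.or' α β)) = ES.B (circ Ψ α) ∩ ES.B (circ Ψ β)

/-- Extended credibility-limited revision operator: satisfies (ECL1)–(ECL7). -/
def ECLRev (ES : EpistemicSpace V E) (circ : E → Form V → E) : Prop :=
  ECL1 ES circ ∧ ECL2 ES circ ∧ ECL3 ES circ ∧ ECL4 ES circ ∧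
    ECL5 ES circ ∧ ECL6 ES circ ∧ ECL7 ES circ

/-- `min(X,⪯) = {ω ∈ X : ω ⪯ ω' for all ω' ∈ X}`. -/
def minSet {W : Type} (X : Set W) (le : W → W → Prop) : Set W :=
  {ω ∈ X | ∀ ω' ∈ X, le ω ω'}

/-- The data of a credibility-limited assignment `Ψ ↦ (⪯_Ψ, C_Ψ, b_Ψ)`
(with `b_Ψ = ⊤` rendered as `true`, `b_Ψ = ⊥` as `false`). -/
structure CLAssignment (V E : Type) where
  le : E → World V → World V → Prop
  C : E → Set (World V)
  b : E → Bool

/-- `A` is a credibility-limited assignment for `ES`: `⟦Ψ⟧ ⊆ C_Ψ`,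
`⪯_Ψ` is a total preorder on `C_Ψ`, and (CLA⊥): if `b_Ψ = ⊥` then `C_Ψ = Ω`. -/
def IsCLAssignment (ES : EpistemicSpace V E) (A : CLAssignment V E) : Prop :=
  (∀ Ψ, modsOf ES Ψ ⊆ A.C Ψ) ∧
  (∀ Ψ, ∀ ω₁ ∈ A.C Ψ, ∀ ω₂ ∈ A.C Ψ, A.le Ψ ω₁ ω₂ ∨ A.le Ψ ω₂ ω₁) ∧
  (∀ Ψ, ∀ ω₁ ∈ A.C Ψ, ∀ ω₂ ∈ A.C Ψ, ∀ ω₃ ∈ A.C Ψ,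
      A.le Ψ ω₁ ω₂ → A.le Ψ ω₂ ω₃ → A.le Ψ ω₁ ω₃) ∧
  (∀ Ψ, A.b Ψ = false → A.C Ψ = Set.univ)

/-- Faithfulness: (CLFA1) and (CLFA2). -/
def Faithful (ES : EpistemicSpace V E) (A : CLAssignment V E) : Prop :=
  (∀ (Ψ : E) (ω₁ ω₂ : World V), ω₁ ∈ modsOf ES Ψ → ω₂ ∈ modsOf ES Ψ →
      A.le Ψ ω₁ ω₂ ∧ A.le Ψ ω₂ ω₁) ∧
  (∀ (Ψ : E) (ω₁ ω₂ : World V), ω₁ ∈ modsOf ES Ψ → ω₂ ∉ modsOf ES Ψ →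
      A.le Ψ ω₁ ω₂ ∧ ¬ A.le Ψ ω₂ ω₁)

/-- Revision-compatibility of an assignment with a belief change operator:
`⟦Ψ∘α⟧ = min(⟦α⟧,⪯_Ψ)` if `⟦α⟧ ∩ C_Ψ ≠ ∅`; `⟦Ψ∘α⟧ = ∅` if `⟦α⟧ = ∅` and
`b_Ψ = ⊥`; and `⟦Ψ∘α⟧ = ⟦Ψ⟧` otherwise. -/
def RevCompatible (ES : EpistemicSpace V E) (circ : E → Form V → E)
    (A : CLAssignment V E) : Prop :=
  ∀ Ψ α,
    ((mods α ∩ A.C Ψ).Nonempty →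
      modsOf ES (circ Ψ α) = minSet (mods α) (A.le Ψ)) ∧
    (mods α = ∅ → A.b Ψ = false → modsOf ES (circ Ψ α) = ∅) ∧
    (¬ (mods α ∩ A.C Ψ).Nonempty → ¬ (mods α = ∅ ∧ A.b Ψ = false) →
      modsOf ES (circ Ψ α) = modsOf ES Ψ)


theorem mods_or' {V : Type} (φ ψ : Form V) : mods (Form.or' φ ψ) = mods φ ∪ mods ψ := by
  ext w
  simp [mods, Form.or', Form.neg, Form.eval]

/-- A belief set is determined by its models. -/
theorem EpistemicSpace.B_eq_of_modsOf_eq {V E : Type} (ES : EpistemicSpace V E) {Ψ Φ : E}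
    (h : modsOf ES Ψ = modsOf ES Φ) : ES.B Ψ = ES.B Φ := by
  rw [ES.closed Ψ, ES.closed Φ]
  unfold modsOf at h
  simp only [Cn, h]

/-- Revising by a formula whose only model `ω` is not credible leaves the beliefs unchanged. -/
theorem ECLRev.B_eq_of_mods_eq_singleton {V E : Type} {ES : EpistemicSpace V E}
    {circ : E → Form V → E} (h : ECLRev ES circ) {Ψ : E} {φ : Form V} {ω : World V}
    (hφ : mods φ = {ω}) (hω : modsOf ES (circ Ψ φ) ≠ {ω}) :
    ES.B (circ Ψ φ) = ES.B Ψ := by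
  obtain ⟨h1, -, h3, -⟩ := h
  refine (h1 Ψ φ).elim (fun hmem => ?_) id
  have hsub : modsOf ES (circ Ψ φ) ⊆ {ω} := hφ ▸ fun w hw => hw φ hmem
  have hempty : modsOf ES (circ Ψ φ) = ∅ :=
    (Set.subset_singleton_iff_eq.mp hsub).resolve_right hω
  have hΨ : ¬ SetConsistent (ES.B Ψ) :=
    (h3 Ψ φ (Set.not_nonempty_iff_eq_empty.mpr hempty)).resolve_right
      (not_not_intro ⟨ω, by simp [hφ]⟩)
  exact ES.B_eq_of_modsOf_eq (hempty.trans (Set.not_nonempty_iff_eq_empty.mp hΨ).symm)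

/-- Every nonempty finite set of non-credible worlds is the set of models of a formula
by which revision leaves the beliefs unchanged. -/
theorem ECLRev.exists_mods_eq_and_B_eq {V E : Type} {ES : EpistemicSpace V E}
    {circ : E → Form V → E} (h : ECLRev ES circ) {g : World V → Form V}
    (hg : ∀ ω, mods (g ω) = {ω}) {Ψ : E} {S : Finset (World V)} (hS : S.Nonempty)
    (hC : ∀ ω ∈ S, modsOf ES (circ Ψ (g ω)) ≠ {ω}) :
    ∃ β : Form V, mods β = S ∧ ES.B (circ Ψ β) = ES.B Ψ := by
  induction hS using Finset.Nonempty.cons_induction with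
  | singleton ω =>
    exact ⟨g ω, by simp [hg], h.B_eq_of_mods_eq_singleton (hg ω) (hC ω (by simp))⟩
  | cons ω S _ _ ih =>
    obtain ⟨β, hβ, hB⟩ := ih fun w hw => hC w (Finset.mem_cons_of_mem hw)
    have hBω := h.B_eq_of_mods_eq_singleton (hg ω) (hC ω (Finset.mem_cons_self ω S))
    obtain ⟨-, -, -, -, -, -, h7⟩ := h
    refine ⟨Form.or' (g ω) β, by simp [mods_or', hg, hβ], ?_⟩
    simpa [hB, hBω] using h7 Ψ (g ω) β

/-- For an extended credibility-limited revision operator, with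
`C_Ψ = {ω : ⟦Ψ∘φ_ω⟧ = {ω}}`: for every consistent `α` with `⟦α⟧ ∩ C_Ψ = ∅`,
it holds that `⟦Ψ∘α⟧ = ⟦Ψ⟧`. -/
theorem stmt18 {V E : Type} [Nonempty V] [Fintype V] [Nonempty E]
    (ES : EpistemicSpace V E) (circ : E → Form V → E)
    (h : ECLRev ES circ)
    (g : World V → Form V) (hg : ∀ ω : World V, mods (g ω) = {ω})
    (Ψ : E) (α : Form V)
    (hα : FormConsistent α)
    (hdisj : mods α ∩ {ω : World V | modsOf ES (circ Ψ (g ω)) = {ω}} = ∅) :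
    modsOf ES (circ Ψ α) = modsOf ES Ψ := by
  have hfin := (mods α).toFinite
  obtain ⟨β, hβ, hB⟩ := h.exists_mods_eq_and_B_eq hg (Ψ := Ψ) (S := hfin.toFinset)
    (hfin.toFinset_nonempty.mpr hα)
    fun ω hω hC => hdisj.subset ⟨hfin.mem_toFinset.mp hω, hC⟩
  obtain ⟨-, -, -, -, h5, -⟩ := h
  unfold modsOf
  rw [h5 Ψ α β (by rw [hβ, hfin.coe_toFinset]), hB]

end CLR
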